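/- Suppose the sign of the edge {u,v} is flipped from + to −, and suppose u and w are in ε-agreement in G⁺. If either (a) w ∈ N_{G⁺}(u) \ N_{G⁺}(v), w ≠ v, and |N_{G⁺}(u)| ≤ |N_{G⁺}(w)|, or (b) w ∈ N_{G⁺}(u) \ N_{G⁺}(v), w ≠ v, |N_{G⁺}(u)| > |N_{G⁺}(w)|, and |N_{G⁺}(u) Δ N_{G⁺}(w)| ≤ |N_{G⁺}(u)|, then u and w are in ε-agreement in H⁺. -/

import Mathlib

open SimpleGraph

/-- `NonAgreement G x y = |N_G(x) Δ N_G(y)| / max(|N_G(x)|, |N_G(y)|)` as a rational number. -/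
noncomputable def NonAgreement {V : Type*} [Fintype V] (G : SimpleGraph V) (x y : V) : ℚ :=
  ((symmDiff (G.neighborSet x) (G.neighborSet y)).ncard : ℚ) /
    ((max (G.neighborSet x).ncard (G.neighborSet y).ncard : ℕ) : ℚ)

/-- Vertices `x` and `y` are in `ε`-agreement in `G` if they are adjacent
and `NonAgreement G x y < ε`. -/
def EpsAgree {V : Type*} [Fintype V] (ε : ℚ) (G : SimpleGraph V) (x y : V) : Prop :=
  G.Adj x y ∧ NonAgreement G x y < ε

theorem neighborSet_deleteEdges_left {V : Type*} (G : SimpleGraph V) (u v : V) :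
    (G.deleteEdges {s(u, v)}).neighborSet u = G.neighborSet u \ {v} := by
  ext x
  simp only [mem_neighborSet, deleteEdges_adj, Set.mem_singleton_iff, Set.mem_sdiff]
  have := fun h : G.Adj u x => h.ne'
  grind [Sym2.eq_iff]

theorem neighborSet_deleteEdges_of_ne {V : Type*} {G : SimpleGraph V} {u v w : V}
    (hu : w ≠ u) (hv : w ≠ v) :
    (G.deleteEdges {s(u, v)}).neighborSet w = G.neighborSet w := by
  ext x
  simp [deleteEdges_adj, hu, hv]

theorem symmDiff_sdiff_singleton {α : Type*} {s t : Set α} {a : α} (ht : a ∉ t) :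
    symmDiff (s \ {a}) t = symmDiff s t \ {a} := by
  ext x
  by_cases hx : x = a
  · subst hx
    simp [Set.mem_symmDiff, ht]
  · simp [Set.mem_symmDiff, hx]

theorem stmt16 {V : Type*} [Fintype V] (G H : SimpleGraph V) (u v w : V) (ε : ℚ) (hε : 0 < ε)
    (huv : u ≠ v) (hadj : G.Adj u v)
    (hH : H = G.deleteEdges {s(u, v)})
    (hagree : EpsAgree ε G u w)
    (hcase : (w ∈ G.neighborSet u \ G.neighborSet v ∧ w ≠ v ∧
        (G.neighborSet u).ncard ≤ (G.neighborSet w).ncard) ∨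
      (w ∈ G.neighborSet u \ G.neighborSet v ∧ w ≠ v ∧
        (G.neighborSet u).ncard > (G.neighborSet w).ncard ∧
        (symmDiff (G.neighborSet u) (G.neighborSet w)).ncard ≤ (G.neighborSet u).ncard)) :
    EpsAgree ε H u w := by
  subst hH
  obtain ⟨huw, hlt⟩ := hagree
  have hwv : w ≠ v := by rcases hcase with h | h <;> exact h.2.1
  have hnot : ¬ G.Adj v w := by rcases hcase with h | h <;> exact h.1.2
  have hvw : v ∉ G.neighborSet w := fun h => hnot h.symm
  refine ⟨by simp [SimpleGraph.deleteEdges_adj, huw, hwv, huv], lt_of_le_of_lt ?_ hlt⟩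
  unfold NonAgreement
  rw [neighborSet_deleteEdges_left, neighborSet_deleteEdges_of_ne huw.ne' hwv,
    symmDiff_sdiff_singleton hvw]
  have hd := Set.ncard_sdiff_singleton_add_one
    (show v ∈ symmDiff (G.neighborSet u) (G.neighborSet w) from Or.inl ⟨hadj, hvw⟩)
  have hn := Set.ncard_sdiff_singleton_add_one (show v ∈ G.neighborSet u from hadj)
  have hpos : 0 < (G.neighborSet w).ncard := (Set.ncard_pos (Set.toFinite _)).mpr ⟨u, huw.symm⟩
  rw [← hd, ← hn] at hcase ⊢
  generalize (symmDiff (G.neighborSet u) (G.neighborSet w) \ {v}).ncard = d at *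
  generalize (G.neighborSet u \ {v}).ncard = n at *
  generalize (G.neighborSet w).ncard = m at *
  rcases hcase with ⟨-, -, h⟩ | ⟨-, -, h, h'⟩
  · rw [max_eq_right h, max_eq_right (by omega)]
    gcongr
    omega
  · rw [max_eq_left h.le, max_eq_left (by omega)]
    have hn0 : (0 : ℚ) < n := by exact_mod_cast (by omega : 0 < n)
    have hdn : (d : ℚ) ≤ n := by exact_mod_cast (by omega : d ≤ n)
    rw [div_le_div_iff₀ hn0 (by positivity)]
    push_cast
    linarith
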